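/- arXiv:1210.7291 — 2 statements merged into one kernel-verified Lean document; each statement's English description precedes it below -/
import Mathlib

section
/- There exists a sequence of integers (n_k)_{k≥1} with n₁ ≥ 3 and n_{k+1} ≥ 12 n_k² for all k ≥ 1, such that for every K ≥ 1 the following holds with A = ∪_{k=1}^{K} A(n_k): whenever (j₁, j₂, j₃, ℓ₁, p₁, p₂) ∈ ℤ⁶ satisfies j₁ + j₂ + j₃ = ℓ₁ + p₁ + p₂ and j₁² + j₂² + j₃² = ℓ₁² + p₁² + p₂², and j₁, j₂, j₃, ℓ₁ ∈ A, then also p₁ ∈ A and p₂ ∈ A. -/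
/-- For an integer `n`, the resonant cluster `A(n) = {n-2, n-1, n+1, n+2}`. -/
def resonantCluster (n : ℤ) : Set ℤ := {n - 2, n - 1, n + 1, n + 2}

lemma exists_large_forall_sq_ne (B M : ℤ) (hM : 0 ≤ M) (hB : 0 ≤ B) :
    ∃ N, M ≤ N ∧ B ≤ N ∧ ∀ e E x : ℤ, 1 ≤ e → e ≤ B → -B ≤ E → E ≤ B →
      x ^ 2 ≠ 4 * N * e + E := by
  by_contra! hcon
  set S : Finset (ℤ × ℤ) := Finset.Icc 1 B ×ˢ Finset.Icc (-B) B
  set R : ℤ := 4 * B * (S.card + 1)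
  have hR : 0 ≤ R := by positivity
  have hbad : ∀ t : ℕ, ∃ z : ℤ × ℤ × ℤ, 1 ≤ z.1 ∧ z.1 ≤ B ∧ -B ≤ z.2.1 ∧ z.2.1 ≤ B ∧ 0 ≤ z.2.2 ∧
      z.2.2 ^ 2 = 4 * (M + B + R ^ 2 + t) * z.1 + z.2.1 := fun t => by
    obtain ⟨e, E, x, h1, h2, h3, h4, h5⟩ := hcon (M + B + R ^ 2 + t) (by nlinarith)
      (by nlinarith)
    exact ⟨(e, E, |x|), h1, h2, h3, h4, abs_nonneg x, by simpa only [sq_abs] using h5⟩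
  choose z he₁ heB hE₁ hEB hx hz using hbad
  obtain ⟨t₁, ht₁, t₂, ht₂, hne, heq⟩ := Finset.exists_ne_map_eq_of_card_lt_of_maps_to
    (s := Finset.range (S.card + 1)) (t := S) (f := fun t => ((z t).1, (z t).2.1))
    (by simp) (fun t _ => by simp [S, he₁, heB, hE₁, hEB])
  wlog hlt : t₁ < t₂ generalizing t₁ t₂
  · exact this t₂ ht₂ t₁ ht₁ hne.symm heq.symm (by omega)
  obtain ⟨h1, h2⟩ := Prod.mk.inj heq
  have ht : (t₂ : ℤ) ≤ S.card := by
    have := Finset.mem_range.1 ht₂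
    omega
  have ht' : (t₁ : ℤ) + 1 ≤ t₂ := by omega
  have hz₁ := hz t₁
  have hz₂ := hz t₂
  rw [← h1, ← h2] at hz₂
  have hpos := he₁ t₁
  have hle := heB t₁
  have hlow := hE₁ t₁
  have hx₁ := hx t₁
  have hx₂ := hx t₂
  generalize (z t₁).1 = e at *
  generalize (z t₁).2.1 = E at *
  generalize (z t₁).2.2 = x at *
  generalize (z t₂).2.2 = y at *
  have hdiff : y ^ 2 - x ^ 2 = 4 * e * (t₂ - t₁) := by linear_combination hz₂ - hz₁
  have hdiffR : y ^ 2 - x ^ 2 ≤ R := by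
    rw [hdiff]
    exact mul_le_mul (by linarith) (by omega) (by omega) (by linarith)
  have hxy : x < y := by
    refine lt_of_pow_lt_pow_left₀ 2 hx₂ ?_
    have : 0 < 4 * e * ((t₂ : ℤ) - t₁) := by
      apply mul_pos <;> omega
    linarith
  have hxR : x ≤ R := by nlinarith
  have hT : 0 ≤ M + B + R ^ 2 + t₁ := by positivity
  have hbig : R ^ 2 < x ^ 2 := by
    have h3 : M + B + R ^ 2 + t₁ ≤ (M + B + R ^ 2 + t₁) * e := le_mul_of_one_le_right hT hpos
    have h4 : 0 < B := by linarith
    have h5 : 0 ≤ R ^ 2 := sq_nonneg R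
    have h6 : (0 : ℤ) ≤ t₁ := by positivity
    linarith
  have := pow_le_pow_left₀ hx₁ hxR 2
  linarith

lemma abs_le_abs_of_mul_eq {a b r : ℤ} (h : a * b = r) (hr : r ≠ 0) : |a| ≤ |r| := by
  subst h
  rw [abs_mul]
  exact le_mul_of_one_le_right (abs_nonneg a) (Int.one_le_abs (right_ne_zero_of_mul hr))

section Resonance

variable {j₁ j₂ j₃ l p q : ℤ}

lemma resonance_mul_eq (h₁ : j₁ + j₂ + j₃ = l + p + q)
    (h₂ : j₁ ^ 2 + j₂ ^ 2 + j₃ ^ 2 = l ^ 2 + p ^ 2 + q ^ 2) :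
    (j₁ - p) * (j₁ - q) = (l - j₂) * (l - j₃) := by
  have : 2 * ((j₁ - p) * (j₁ - q)) = 2 * ((l - j₂) * (l - j₃)) := by
    linear_combination (2 * j₁ - (j₁ + j₂ + j₃ - l + p + q)) * h₁ + h₂
  linarith

lemma resonance_trivial (h₁ : j₁ + j₂ + j₃ = l + p + q)
    (h₂ : j₁ ^ 2 + j₂ ^ 2 + j₃ ^ 2 = l ^ 2 + p ^ 2 + q ^ 2) (h : l = j₁) :
    (p = j₂ ∧ q = j₃) ∨ (p = j₃ ∧ q = j₂) := by
  subst h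
  have h : (j₂ - p) * (j₂ - q) = 0 := by
    rw [resonance_mul_eq (j₂ := l) (j₃ := j₃) (l := l) (by linarith) (by linarith)]
    simp
  rcases mul_eq_zero.1 h with h | h
  · left; constructor <;> linarith
  · right; constructor <;> linarith

lemma resonance_abs_sub_le (h₁ : j₁ + j₂ + j₃ = l + p + q)
    (h₂ : j₁ ^ 2 + j₂ ^ 2 + j₃ ^ 2 = l ^ 2 + p ^ 2 + q ^ 2) (h : l ≠ j₂) (h' : l ≠ j₃) {r : ℤ}
    (hj₂ : |l - j₂| ≤ r) (hj₃ : |l - j₃| ≤ r) :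
    |j₂ + j₃ - l - j₁| ≤ 2 * r ^ 2 := by
  have hm := resonance_mul_eq h₁ h₂
  have hr : (l - j₂) * (l - j₃) ≠ 0 := mul_ne_zero (sub_ne_zero.2 h) (sub_ne_zero.2 h')
  have hb : |(l - j₂) * (l - j₃)| ≤ r ^ 2 := by
    rw [abs_mul, sq]
    exact mul_le_mul hj₂ hj₃ (abs_nonneg _) ((abs_nonneg _).trans hj₂)
  have hp := abs_le.1 ((abs_le_abs_of_mul_eq hm hr).trans hb)
  have hq := abs_le.1 ((abs_le_abs_of_mul_eq ((mul_comm _ _).trans hm) hr).trans hb)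
  rw [abs_le]
  constructor <;> linarith [hp.1, hp.2, hq.1, hq.2]

lemma resonance_discrim (h₁ : j₁ + j₂ + j₃ = l + p + q)
    (h₂ : j₁ ^ 2 + j₂ ^ 2 + j₃ ^ 2 = l ^ 2 + p ^ 2 + q ^ 2) :
    (p - q) ^ 2 = 2 * (j₁ ^ 2 + j₂ ^ 2 + j₃ ^ 2 - l ^ 2) - (j₁ + j₂ + j₃ - l) ^ 2 := by
  linear_combination (j₁ + j₂ + j₃ - l + p + q) * h₁ - 2 * h₂

/-- `N` is so large and so generic that no nontrivial resonance involves both integers close to `N`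
and integers of absolute value at most `L`. -/
def Separates (L N : ℤ) : Prop :=
  100 * (L + 1) ^ 2 ≤ N ∧ ∀ e E x : ℤ, 1 ≤ e → e ≤ 100 * (L + 1) ^ 2 →
    -(100 * (L + 1) ^ 2) ≤ E → E ≤ 100 * (L + 1) ^ 2 → x ^ 2 ≠ 4 * N * e + E

variable {L N : ℤ}

lemma Separates.eq_zero_of_sq_eq (hN : Separates L N) {e E x : ℤ} (he : |e| ≤ 100 * (L + 1) ^ 2)
    (hE : |E| ≤ 100 * (L + 1) ^ 2) (h : x ^ 2 = 4 * N * e + E) (hL : 0 ≤ L) : e = 0 := by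
  obtain ⟨he₁, he₂⟩ := abs_le.1 he
  obtain ⟨hE₁, hE₂⟩ := abs_le.1 hE
  rcases lt_trichotomy e 0 with hneg | h0 | hpos
  · have hB : 0 < 100 * (L + 1) ^ 2 := by positivity
    have := hN.1
    nlinarith [sq_nonneg x]
  · exact h0
  · exact absurd h (hN.2 e E x hpos he₂ hE₁ hE₂)

lemma Separates.not_top_top_top_low (hN : Separates L N) (hL : 0 ≤ L)
    (h₁ : j₁ + j₂ + j₃ = l + p + q) (h₂ : j₁ ^ 2 + j₂ ^ 2 + j₃ ^ 2 = l ^ 2 + p ^ 2 + q ^ 2)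
    (hj₁ : |j₁ - N| ≤ 2) (hj₂ : |j₂ - N| ≤ 2) (hj₃ : |j₃ - N| ≤ 2) (hl : |l| ≤ L) : False := by
  have hd := resonance_discrim h₁ h₂
  have hB := hN.1
  rw [abs_le] at *
  obtain ⟨a, rfl⟩ : ∃ a, j₁ = N + a := ⟨j₁ - N, by ring⟩
  obtain ⟨b, rfl⟩ : ∃ b, j₂ = N + b := ⟨j₂ - N, by ring⟩
  obtain ⟨c, rfl⟩ : ∃ c, j₃ = N + c := ⟨j₃ - N, by ring⟩
  simp only [add_sub_cancel_left] at *
  have ha : a ^ 2 ≤ 4 := by nlinarith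
  have hb : b ^ 2 ≤ 4 := by nlinarith
  have hc : c ^ 2 ≤ 4 := by nlinarith
  have hNL : 100 * L + 100 ≤ N := by nlinarith
  have hlow : 0 ≤ -3 * N ^ 2 - 2 * (N * (a + b + c)) + 6 * (N * l) + 24 := by
    linear_combination 2 * ha + 2 * hb + 2 * hc + sq_nonneg (p - q) + 2 * sq_nonneg l +
      sq_nonneg (a + b + c - l) + hd
  have hup : 0 ≤ N * (3 * N + 2 * (a + b + c) - 6 * l - 2 * N) :=
    mul_nonneg (by linarith) (by linarith)
  nlinarith

lemma Separates.eq_of_top_top_low_low (hN : Separates L N) (hL : 0 ≤ L)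
    (h₁ : j₁ + j₂ + j₃ = l + p + q) (h₂ : j₁ ^ 2 + j₂ ^ 2 + j₃ ^ 2 = l ^ 2 + p ^ 2 + q ^ 2)
    (hj₁ : |j₁ - N| ≤ 2) (hj₂ : |j₂ - N| ≤ 2) (hj₃ : |j₃| ≤ L) (hl : |l| ≤ L) : l = j₃ := by
  obtain ⟨a, rfl⟩ : ∃ a, j₁ = N + a := ⟨j₁ - N, by ring⟩
  obtain ⟨b, rfl⟩ : ∃ b, j₂ = N + b := ⟨j₂ - N, by ring⟩
  simp only [add_sub_cancel_left, abs_le] at *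
  have hd := resonance_discrim h₁ h₂
  suffices l - j₃ = 0 by linarith
  refine hN.eq_zero_of_sq_eq (x := p - q)
    (E := 2 * (a ^ 2 + b ^ 2) + 2 * (j₃ ^ 2 - l ^ 2) - (a + b + j₃ - l) ^ 2)
    (abs_le.2 ⟨by nlinarith, by nlinarith⟩) ?_ (by linear_combination hd) hL
  have ha : a ^ 2 ≤ 4 := by nlinarith
  have hb : b ^ 2 ≤ 4 := by nlinarith
  have hj : j₃ ^ 2 ≤ L ^ 2 := by nlinarith
  have hl : l ^ 2 ≤ L ^ 2 := by nlinarith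
  have hs : (a + b + j₃ - l) ^ 2 ≤ (4 + 2 * L) ^ 2 := sq_le_sq' (by linarith) (by linarith)
  rw [abs_le]
  constructor <;> nlinarith [sq_nonneg a, sq_nonneg b, sq_nonneg j₃, sq_nonneg l,
    sq_nonneg (a + b + j₃ - l)]

lemma Separates.eq_of_top_low_low_top (hN : Separates L N) (hL : 0 ≤ L)
    (h₁ : j₁ + j₂ + j₃ = l + p + q) (h₂ : j₁ ^ 2 + j₂ ^ 2 + j₃ ^ 2 = l ^ 2 + p ^ 2 + q ^ 2)
    (hj₁ : |j₁ - N| ≤ 2) (hj₂ : |j₂| ≤ L) (hj₃ : |j₃| ≤ L) (hl : |l - N| ≤ 2) : l = j₁ := by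
  obtain ⟨a, rfl⟩ : ∃ a, j₁ = N + a := ⟨j₁ - N, by ring⟩
  obtain ⟨b, rfl⟩ : ∃ b, l = N + b := ⟨l - N, by ring⟩
  simp only [add_sub_cancel_left, abs_le] at *
  have hd := resonance_discrim h₁ h₂
  suffices a - b = 0 by linarith
  refine hN.eq_zero_of_sq_eq (x := p - q)
    (E := 2 * (a ^ 2 - b ^ 2) + 2 * (j₂ ^ 2 + j₃ ^ 2) - (a - b + j₂ + j₃) ^ 2)
    (abs_le.2 ⟨by nlinarith, by nlinarith⟩) ?_ (by linear_combination hd) hL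
  have ha : a ^ 2 ≤ 4 := by nlinarith
  have hb : b ^ 2 ≤ 4 := by nlinarith
  have hj₂ : j₂ ^ 2 ≤ L ^ 2 := by nlinarith
  have hj₃ : j₃ ^ 2 ≤ L ^ 2 := by nlinarith
  have hs : (a - b + j₂ + j₃) ^ 2 ≤ (4 + 2 * L) ^ 2 := sq_le_sq' (by linarith) (by linarith)
  rw [abs_le]
  constructor <;> nlinarith [sq_nonneg a, sq_nonneg b, sq_nonneg j₂, sq_nonneg j₃,
    sq_nonneg (a - b + j₂ + j₃)]

lemma Separates.eq_or_eq_of_top_top_low_top (hN : Separates L N) (hL : 0 ≤ L)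
    (h₁ : j₁ + j₂ + j₃ = l + p + q) (h₂ : j₁ ^ 2 + j₂ ^ 2 + j₃ ^ 2 = l ^ 2 + p ^ 2 + q ^ 2)
    (hj₁ : |j₁ - N| ≤ 2) (hj₂ : |j₂ - N| ≤ 2) (hj₃ : |j₃| ≤ L) (hl : |l - N| ≤ 2) :
    l = j₁ ∨ l = j₂ := by
  by_contra! hne
  simp only [abs_le] at hj₁ hj₂ hj₃ hl
  have h := resonance_abs_sub_le (j₁ := j₃) (j₂ := j₁) (j₃ := j₂) (p := p) (q := q) (r := 4)
    (by linarith) (by linarith) hne.1 hne.2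
    (abs_le.2 ⟨by linarith, by linarith⟩) (abs_le.2 ⟨by linarith, by linarith⟩)
  have := hN.1
  nlinarith [abs_le.1 h]

lemma Separates.eq_or_eq_of_top_low_low_low (hN : Separates L N) (hL : 0 ≤ L)
    (h₁ : j₁ + j₂ + j₃ = l + p + q) (h₂ : j₁ ^ 2 + j₂ ^ 2 + j₃ ^ 2 = l ^ 2 + p ^ 2 + q ^ 2)
    (hj₁ : |j₁ - N| ≤ 2) (hj₂ : |j₂| ≤ L) (hj₃ : |j₃| ≤ L) (hl : |l| ≤ L) :
    l = j₂ ∨ l = j₃ := by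
  by_contra! hne
  simp only [abs_le] at hj₁ hj₂ hj₃ hl
  have h := resonance_abs_sub_le (r := 2 * L) h₁ h₂ hne.1 hne.2
    (abs_le.2 ⟨by linarith, by linarith⟩) (abs_le.2 ⟨by linarith, by linarith⟩)
  have := hN.1
  nlinarith [abs_le.1 h]

lemma Separates.not_low_low_low_top (hN : Separates L N) (hL : 0 ≤ L)
    (h₂ : j₁ ^ 2 + j₂ ^ 2 + j₃ ^ 2 = l ^ 2 + p ^ 2 + q ^ 2)
    (hj₁ : |j₁| ≤ L) (hj₂ : |j₂| ≤ L) (hj₃ : |j₃| ≤ L) (hl : |l - N| ≤ 2) : False := by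
  have hj₁' := sq_le_sq' (abs_le.1 hj₁).1 (abs_le.1 hj₁).2
  have hj₂' := sq_le_sq' (abs_le.1 hj₂).1 (abs_le.1 hj₂).2
  have hj₃' := sq_le_sq' (abs_le.1 hj₃).1 (abs_le.1 hj₃).2
  have := hN.1
  have hlL : 2 * L + 2 ≤ l := by nlinarith [(abs_le.1 hl).1]
  nlinarith [sq_nonneg p, sq_nonneg q]

/-- A resonance among four integers, each of absolute value at most `L` or close to `N`, and not
all small, is trivial or has all of them close to `N`. -/
lemma Separates.eq_or_forall_top (hN : Separates L N) (hL : 0 ≤ L)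
    (h₁ : j₁ + j₂ + j₃ = l + p + q) (h₂ : j₁ ^ 2 + j₂ ^ 2 + j₃ ^ 2 = l ^ 2 + p ^ 2 + q ^ 2)
    (hj₁ : |j₁| ≤ L ∨ |j₁ - N| ≤ 2) (hj₂ : |j₂| ≤ L ∨ |j₂ - N| ≤ 2)
    (hj₃ : |j₃| ≤ L ∨ |j₃ - N| ≤ 2) (hl : |l| ≤ L ∨ |l - N| ≤ 2) :
    l = j₁ ∨ l = j₂ ∨ l = j₃ ∨ (|j₁| ≤ L ∧ |j₂| ≤ L ∧ |j₃| ≤ L ∧ |l| ≤ L) ∨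
      (|j₁ - N| ≤ 2 ∧ |j₂ - N| ≤ 2 ∧ |j₃ - N| ≤ 2 ∧ |l - N| ≤ 2) := by
  have s₁ : j₁ + j₃ + j₂ = l + p + q := by linarith
  have s₂ : j₂ + j₃ + j₁ = l + p + q := by linarith
  have s₃ : j₂ + j₁ + j₃ = l + p + q := by linarith
  have s₄ : j₃ + j₁ + j₂ = l + p + q := by linarith
  have q₁ : j₁ ^ 2 + j₃ ^ 2 + j₂ ^ 2 = l ^ 2 + p ^ 2 + q ^ 2 := by linarith
  have q₂ : j₂ ^ 2 + j₃ ^ 2 + j₁ ^ 2 = l ^ 2 + p ^ 2 + q ^ 2 := by linarith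
  have q₃ : j₂ ^ 2 + j₁ ^ 2 + j₃ ^ 2 = l ^ 2 + p ^ 2 + q ^ 2 := by linarith
  have q₄ : j₃ ^ 2 + j₁ ^ 2 + j₂ ^ 2 = l ^ 2 + p ^ 2 + q ^ 2 := by linarith
  rcases hj₁ with hj₁ | hj₁ <;> rcases hj₂ with hj₂ | hj₂ <;> rcases hj₃ with hj₃ | hj₃ <;>
    rcases hl with hl | hl
  · tauto
  · exact (hN.not_low_low_low_top hL h₂ hj₁ hj₂ hj₃ hl).elim
  · have := hN.eq_or_eq_of_top_low_low_low hL s₄ q₄ hj₃ hj₁ hj₂ hl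
    tauto
  · have := hN.eq_of_top_low_low_top hL s₄ q₄ hj₃ hj₁ hj₂ hl
    tauto
  · have := hN.eq_or_eq_of_top_low_low_low hL s₃ q₃ hj₂ hj₁ hj₃ hl
    tauto
  · have := hN.eq_of_top_low_low_top hL s₃ q₃ hj₂ hj₁ hj₃ hl
    tauto
  · have := hN.eq_of_top_top_low_low hL s₂ q₂ hj₂ hj₃ hj₁ hl
    tauto
  · have := hN.eq_or_eq_of_top_top_low_top hL s₂ q₂ hj₂ hj₃ hj₁ hl
    tauto
  · have := hN.eq_or_eq_of_top_low_low_low hL h₁ h₂ hj₁ hj₂ hj₃ hl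
    tauto
  · have := hN.eq_of_top_low_low_top hL h₁ h₂ hj₁ hj₂ hj₃ hl
    tauto
  · have := hN.eq_of_top_top_low_low hL s₁ q₁ hj₁ hj₃ hj₂ hl
    tauto
  · have := hN.eq_or_eq_of_top_top_low_top hL s₁ q₁ hj₁ hj₃ hj₂ hl
    tauto
  · have := hN.eq_of_top_top_low_low hL h₁ h₂ hj₁ hj₂ hj₃ hl
    tauto
  · have := hN.eq_or_eq_of_top_top_low_top hL h₁ h₂ hj₁ hj₂ hj₃ hl
    tauto
  · exact (hN.not_top_top_top_low hL h₁ h₂ hj₁ hj₂ hj₃ hl).elim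
  · tauto

lemma mem_resonantCluster {n x : ℤ} :
    x ∈ resonantCluster n ↔ x = n - 2 ∨ x = n - 1 ∨ x = n + 1 ∨ x = n + 2 := Iff.rfl

lemma abs_sub_le_of_mem_resonantCluster {n x : ℤ} (h : x ∈ resonantCluster n) : |x - n| ≤ 2 := by
  rw [mem_resonantCluster] at h
  rw [abs_le]
  omega

lemma mem_resonantCluster_iff_sq {n x : ℤ} :
    x ∈ resonantCluster n ↔ (x - n) ^ 2 = 1 ∨ (x - n) ^ 2 = 4 := by
  rw [mem_resonantCluster, sq_eq_one_iff, show (4 : ℤ) = 2 ^ 2 by norm_num, sq_eq_sq_iff_eq_or_eq_neg]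
  omega

lemma resonance_mem_resonantCluster {n : ℤ} (h₁ : j₁ + j₂ + j₃ = l + p + q)
    (h₂ : j₁ ^ 2 + j₂ ^ 2 + j₃ ^ 2 = l ^ 2 + p ^ 2 + q ^ 2) (hj₁ : j₁ ∈ resonantCluster n)
    (hj₂ : j₂ ∈ resonantCluster n) (hj₃ : j₃ ∈ resonantCluster n) (hl : l ∈ resonantCluster n) :
    p ∈ resonantCluster n ∧ q ∈ resonantCluster n := by
  simp only [mem_resonantCluster_iff_sq] at *
  have h : (j₁ - n) ^ 2 + (j₂ - n) ^ 2 + (j₃ - n) ^ 2 = (l - n) ^ 2 + (p - n) ^ 2 + (q - n) ^ 2 := by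
    linear_combination h₂ - 2 * n * h₁
  have hs : (p - n) ^ 2 + (q - n) ^ 2 ≤ 11 ∧ ((p - n) ^ 2 + (q - n) ^ 2) % 3 = 2 := by
    rcases hj₁ with hj₁ | hj₁ <;> rcases hj₂ with hj₂ | hj₂ <;> rcases hj₃ with hj₃ | hj₃ <;>
      rcases hl with hl | hl <;> rw [hj₁, hj₂, hj₃, hl] at h <;> omega
  clear * - hs
  generalize p - n = x at *
  generalize q - n = y at *
  obtain ⟨hp₁, hp₂⟩ := abs_le.1 (abs_le_of_sq_le_sq (a := x) (b := 4)
    (by nlinarith [sq_nonneg y]) (by norm_num))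
  obtain ⟨hq₁, hq₂⟩ := abs_le.1 (abs_le_of_sq_le_sq (a := y) (b := 4)
    (by nlinarith [sq_nonneg x]) (by norm_num))
  interval_cases x <;> interval_cases y <;> simp_all

end Resonance

lemma exists_separates (L M : ℤ) (hM : 0 ≤ M) : ∃ N, M ≤ N ∧ Separates L N := by
  obtain ⟨N, h₁, h₂, h₃⟩ := exists_large_forall_sq_ne (100 * (L + 1) ^ 2) M hM (by positivity)
  exact ⟨N, h₁, h₂, h₃⟩

lemma exists_separating_sequence :
    ∃ n : ℕ → ℤ, (∀ k, 3 ≤ n k) ∧ ∀ k, 12 * n k ^ 2 ≤ n (k + 1) ∧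
      Separates (n k + 2) (n (k + 1)) := by
  choose f hf hsep using fun m : ℤ =>
    exists_separates (m + 2) (12 * m ^ 2 + 3) (by positivity)
  refine ⟨fun k => f^[k] 3, fun k => ?_, fun k => ?_⟩
  · cases k with
    | zero => simp
    | succ k =>
      simp only [Function.iterate_succ_apply']
      nlinarith [hf (f^[k] 3)]
  · simp only [Function.iterate_succ_apply']
    exact ⟨by linarith [hf (f^[k] 3)], hsep _⟩

/-- There exists a sequence `(n_k)_{k≥1}` of integers with `n₁ ≥ 3` and
`n_{k+1} ≥ 12 n_k²` such that, for every `K ≥ 1`, with `A = ∪_{k=1}^K A(n_k)`: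
whenever `j₁ + j₂ + j₃ = ℓ₁ + p₁ + p₂`, `j₁² + j₂² + j₃² = ℓ₁² + p₁² + p₂²`
and `j₁, j₂, j₃, ℓ₁ ∈ A`, then also `p₁, p₂ ∈ A`. -/
theorem exists_nonresonant_sequence :
    ∃ n : ℕ → ℤ, 3 ≤ n 1 ∧ (∀ k, 1 ≤ k → 12 * (n k) ^ 2 ≤ n (k + 1)) ∧
      ∀ K : ℕ, 1 ≤ K →
      ∀ j₁ j₂ j₃ ℓ₁ p₁ p₂ : ℤ,
        j₁ + j₂ + j₃ = ℓ₁ + p₁ + p₂ →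
        j₁ ^ 2 + j₂ ^ 2 + j₃ ^ 2 = ℓ₁ ^ 2 + p₁ ^ 2 + p₂ ^ 2 →
        (∃ k, 1 ≤ k ∧ k ≤ K ∧ j₁ ∈ resonantCluster (n k)) →
        (∃ k, 1 ≤ k ∧ k ≤ K ∧ j₂ ∈ resonantCluster (n k)) →
        (∃ k, 1 ≤ k ∧ k ≤ K ∧ j₃ ∈ resonantCluster (n k)) →
        (∃ k, 1 ≤ k ∧ k ≤ K ∧ ℓ₁ ∈ resonantCluster (n k)) →
        (∃ k, 1 ≤ k ∧ k ≤ K ∧ p₁ ∈ resonantCluster (n k)) ∧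
        (∃ k, 1 ≤ k ∧ k ≤ K ∧ p₂ ∈ resonantCluster (n k)) := by
  obtain ⟨n, h3, hn⟩ := exists_separating_sequence
  have hmono : Monotone n := monotone_nat_of_le_succ fun k => by nlinarith [h3 k, (hn k).1]
  refine ⟨n, h3 1, fun k _ => (hn k).1, fun K _ => ?_⟩
  clear * - n h3 hn hmono
  induction K with
  | zero =>
    rintro j₁ j₂ j₃ l p q - - ⟨k, hk, hk', -⟩
    omega
  | succ K ih =>
    have hsplit : ∀ x, (∃ k, 1 ≤ k ∧ k ≤ K + 1 ∧ x ∈ resonantCluster (n k)) →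
        (|x| ≤ n K + 2 ∧ ∃ k, 1 ≤ k ∧ k ≤ K ∧ x ∈ resonantCluster (n k)) ∨
        (|x - n (K + 1)| ≤ 2 ∧ ¬ |x| ≤ n K + 2 ∧ x ∈ resonantCluster (n (K + 1))) := by
      rintro x ⟨k, hk, hkK, hx⟩
      have hx' := abs_le.1 (abs_sub_le_of_mem_resonantCluster hx)
      rcases Nat.lt_or_ge K k with h | h
      · obtain rfl : k = K + 1 := by omega
        refine .inr ⟨abs_sub_le_of_mem_resonantCluster hx, fun hle => ?_, hx⟩
        nlinarith [hn K, h3 K, (abs_le.1 hle).2]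
      · have := hmono h
        have := h3 k
        exact .inl ⟨abs_le.2 ⟨by linarith, by linarith⟩, k, hk, h, hx⟩
    intro j₁ j₂ j₃ l p q h₁ h₂ hj₁ hj₂ hj₃ hl
    have hlow : ∀ x, (∃ k, 1 ≤ k ∧ k ≤ K + 1 ∧ x ∈ resonantCluster (n k)) → |x| ≤ n K + 2 →
        ∃ k, 1 ≤ k ∧ k ≤ K ∧ x ∈ resonantCluster (n k) := fun x hx hle =>
      (hsplit x hx).elim And.right fun h => absurd hle h.2.1
    have htop : ∀ x, (∃ k, 1 ≤ k ∧ k ≤ K + 1 ∧ x ∈ resonantCluster (n k)) →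
        |x - n (K + 1)| ≤ 2 → x ∈ resonantCluster (n (K + 1)) := fun x hx hle =>
      (hsplit x hx).elim (fun h => by
        have := (abs_le.1 h.1).2
        have := (abs_le.1 hle).1
        nlinarith [hn K, h3 K]) fun h => h.2.2
    rcases (hn K).2.eq_or_forall_top (by linarith [h3 K]) h₁ h₂
      ((hsplit _ hj₁).imp And.left And.left) ((hsplit _ hj₂).imp And.left And.left)
      ((hsplit _ hj₃).imp And.left And.left) ((hsplit _ hl).imp And.left And.left)
      with h | h | h | ⟨t₁, t₂, t₃, t₄⟩ | ⟨t₁, t₂, t₃, t₄⟩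
    · rcases resonance_trivial h₁ h₂ h with ⟨rfl, rfl⟩ | ⟨rfl, rfl⟩ <;> constructor <;> assumption
    · rcases resonance_trivial (j₁ := j₂) (j₂ := j₁) (j₃ := j₃) (p := p) (q := q)
        (by linarith) (by linarith) h with ⟨rfl, rfl⟩ | ⟨rfl, rfl⟩ <;> constructor <;> assumption
    · rcases resonance_trivial (j₁ := j₃) (j₂ := j₁) (j₃ := j₂) (p := p) (q := q)
        (by linarith) (by linarith) h with ⟨rfl, rfl⟩ | ⟨rfl, rfl⟩ <;> constructor <;> assumption
    · obtain ⟨⟨k, hk, hkK, hp⟩, k', hk', hkK', hq⟩ := ih j₁ j₂ j₃ l p q h₁ h₂ (hlow _ hj₁ t₁)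
        (hlow _ hj₂ t₂) (hlow _ hj₃ t₃) (hlow _ hl t₄)
      exact ⟨⟨k, hk, hkK.trans K.le_succ, hp⟩, k', hk', hkK'.trans K.le_succ, hq⟩
    · obtain ⟨hp, hq⟩ := resonance_mem_resonantCluster h₁ h₂ (htop _ hj₁ t₁) (htop _ hj₂ t₂)
        (htop _ hj₃ t₃) (htop _ hl t₄)
      exact ⟨⟨K + 1, by omega, le_rfl, hp⟩, K + 1, by omega, le_rfl, hq⟩
end

section
/- Fix a real parameter C ≥ 9. For every real number T̄ with T̄ > 2π/(9√(C+3)), there exist K₀ ∈ (0, 1/2) and a differentiable function (φ, K) : ℝ → ℝ × (0,1) solving the planar system φ′ = −(9/4)(1−2K)[C + 6(K(1−K))^{1/2} cos(2φ)], K′ = −18(K(1−K))^{3/2} sin(2φ), with φ(0) = 0 and K(0) = K₀, such that φ and K are periodic with period 2T̄ and K(0) + K(T̄) = 1. That is, the set of half-periods realized by such beating orbits contains the whole open interval (2π/(9√(C+3)), +∞). -/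
open Real Set intervalIntegral

/-- A continuous positive `P`-periodic speed on the line generates a global motion from the
origin; the time to advance by `P` is the integral of the reciprocal speed. -/
theorem exists_periodic_motion {v : ℝ → ℝ} {P : ℝ} (hP : 0 < P) (hv : Continuous v)
    (hpos : ∀ x, 0 < v x) (hper : Function.Periodic v P) :
    ∃ x : ℝ → ℝ, x 0 = 0 ∧ (∀ t, HasDerivAt x (v (x t)) t) ∧
      ∀ t, x (t + ∫ y in (0 : ℝ)..P, (v y)⁻¹) = x t + P := by
  have hc : Continuous fun y => (v y)⁻¹ := hv.inv₀ fun y => (hpos y).ne'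
  have hi : ∀ a b, IntervalIntegrable (fun y => (v y)⁻¹) MeasureTheory.volume a b :=
    fun a b => hc.intervalIntegrable a b
  set G : ℝ → ℝ := fun y => ∫ z in (0 : ℝ)..y, (v z)⁻¹ with hG
  have hperi : Function.Periodic (fun y => (v y)⁻¹) P := fun y => by simp only [hper y]
  have hd : ∀ y, HasDerivAt G (v y)⁻¹ y := fun y => hc.integral_hasStrictDerivAt 0 y |>.hasDerivAt
  have hGc : Continuous G := continuous_iff_continuousAt.2 fun y => (hd y).continuousAt
  have hmono : StrictMono G :=
    strictMono_of_hasDerivAt_pos hd fun y => inv_pos.2 (hpos y)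
  have hT : 0 < ∫ y in (0 : ℝ)..P, (v y)⁻¹ :=
    intervalIntegral_pos_of_pos (hi 0 P) (fun y => inv_pos.2 (hpos y)) hP
  have hsurj : Function.Surjective G :=
    hGc.surjective (hperi.tendsto_atTop_intervalIntegral_of_pos hT hP)
      (hperi.tendsto_atBot_intervalIntegral_of_pos hT hP)
  let e : ℝ ≃o ℝ := StrictMono.orderIsoOfSurjective G hmono hsurj
  have he : ∀ y, e y = G y := fun y => rfl
  have hGe : ∀ t, G (e.symm t) = t := fun t => by rw [← he, e.apply_symm_apply]
  have hadd : ∀ y, G (y + P) = G y + ∫ y in (0 : ℝ)..P, (v y)⁻¹ := fun y => by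
    have h := hperi.intervalIntegral_add_eq y 0
    rw [zero_add] at h
    rw [← h]
    exact (integral_add_adjacent_intervals (hi _ _) (hi _ _)).symm
  refine ⟨e.symm, hmono.injective ?_, fun t => ?_, fun t => hmono.injective ?_⟩
  · rw [hGe]; simp [hG]
  · have := HasDerivAt.of_local_left_inverse (f := G) (g := e.symm) (a := t)
      e.symm.continuous.continuousAt (hd _) (inv_pos.2 (hpos _)).ne'
      (Filter.Eventually.of_forall hGe)
    simpa using this
  · rw [hGe, hadd, hGe]

/-- The coordinate `2 (K (1 - K))^{1/2}` as a function of `x = 1 - 2 K`. -/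
noncomputable def sphereRadius (x : ℝ) : ℝ := √(1 - x ^ 2)

/-- Energy deficit, with respect to the center, of the point `φ = 0`, `1 - 2 K = x`. -/
noncomputable def energyDeficit (C x : ℝ) : ℝ := C * x ^ 2 / 4 + (1 - sphereRadius x ^ 3) / 2

/-- Divided difference of the energy deficit with respect to the square of its argument,
expressed through the radii. -/
noncomputable def deficitQuotient (C s s₀ : ℝ) : ℝ :=
  C / 4 + (s ^ 2 + s * s₀ + s₀ ^ 2) / (2 * (s + s₀))

/-- Angular speed along the orbit `1 - 2 K = a cos ψ`. -/
noncomputable def angularSpeed (C a ψ : ℝ) : ℝ :=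
  9 * √(deficitQuotient C (sphereRadius (a * cos ψ)) (sphereRadius a) *
    (sphereRadius (a * cos ψ) ^ 3 - (a * sin ψ) ^ 2 *
      deficitQuotient C (sphereRadius (a * cos ψ)) (sphereRadius a)))

theorem sphereRadius_nonneg (x : ℝ) : 0 ≤ sphereRadius x := sqrt_nonneg _

theorem sphereRadius_le_one (x : ℝ) : sphereRadius x ≤ 1 :=
  sqrt_le_one.2 (by nlinarith [sq_nonneg x])

theorem sphereRadius_pos {x : ℝ} (hx : x ^ 2 < 1) : 0 < sphereRadius x :=
  sqrt_pos.2 (by linarith)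

theorem sphereRadius_sq {x : ℝ} (hx : x ^ 2 ≤ 1) : sphereRadius x ^ 2 = 1 - x ^ 2 :=
  sq_sqrt (by linarith)

theorem continuous_sphereRadius : Continuous sphereRadius := by
  unfold sphereRadius; fun_prop

theorem mul_cos_sq_le (a ψ : ℝ) : (a * cos ψ) ^ 2 ≤ a ^ 2 := by
  rw [mul_pow]; exact mul_le_of_le_one_right (sq_nonneg a) (cos_sq_le_one ψ)

theorem deficitQuotient_pos {C s s₀ : ℝ} (hC : 0 < C) (hs : 0 < s) (hs₀ : 0 < s₀) :
    0 < deficitQuotient C s s₀ := by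
  unfold deficitQuotient; positivity

theorem deficitQuotient_le {C s s₀ : ℝ} (hs : 0 < s) (hs₀ : 0 < s₀) (hs1 : s ≤ 1)
    (hs₀1 : s₀ ≤ 1) : deficitQuotient C s s₀ ≤ C / 4 + 1 := by
  unfold deficitQuotient
  gcongr
  rw [div_le_one (by positivity)]
  nlinarith [mul_pos hs hs₀]

theorem sq_mul_deficitQuotient {C a : ℝ} (ha : a ^ 2 < 1) (ψ : ℝ) :
    (a * sin ψ) ^ 2 * deficitQuotient C (sphereRadius (a * cos ψ)) (sphereRadius a) =
      energyDeficit C a - energyDeficit C (a * cos ψ) := by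
  have hx := (mul_cos_sq_le a ψ).trans_lt ha
  have hs := sphereRadius_pos hx
  have hs₀ := sphereRadius_pos ha
  have h1 := sphereRadius_sq hx.le
  have h2 := sphereRadius_sq ha.le
  have h3 : (a * sin ψ) ^ 2 = a ^ 2 - (a * cos ψ) ^ 2 := by
    rw [mul_pow, mul_pow, sin_sq]; ring
  unfold energyDeficit deficitQuotient
  rw [h3]
  generalize sphereRadius (a * cos ψ) = s at *
  generalize sphereRadius a = s₀ at *
  rw [show a ^ 2 = 1 - s₀ ^ 2 by linarith, show (a * cos ψ) ^ 2 = 1 - s ^ 2 by linarith]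
  field_simp
  ring

theorem sub_sq_mul_deficitQuotient {C a : ℝ} (ha : a ^ 2 < 1) (ψ : ℝ) :
    sphereRadius (a * cos ψ) ^ 3 - (a * sin ψ) ^ 2 *
        deficitQuotient C (sphereRadius (a * cos ψ)) (sphereRadius a) =
      (1 + sphereRadius (a * cos ψ) ^ 3) / 2 + C * (a * cos ψ) ^ 2 / 4 - energyDeficit C a := by
  rw [sq_mul_deficitQuotient ha, energyDeficit.eq_def C (a * cos ψ)]
  ring

theorem one_sub_energyDeficit_le {C a : ℝ} (hC : 9 ≤ C) (ha : a ^ 2 < 1) (ψ : ℝ) :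
    1 - energyDeficit C a ≤ sphereRadius (a * cos ψ) ^ 3 - (a * sin ψ) ^ 2 *
        deficitQuotient C (sphereRadius (a * cos ψ)) (sphereRadius a) := by
  rw [sub_sq_mul_deficitQuotient ha]
  have h := sphereRadius_sq ((mul_cos_sq_le a ψ).trans ha.le)
  have h0 := sphereRadius_nonneg (a * cos ψ)
  have h1 := sphereRadius_le_one (a * cos ψ)
  generalize sphereRadius (a * cos ψ) = s at *
  rw [show (a * cos ψ) ^ 2 = 1 - s ^ 2 by linarith]
  have h2 : 0 ≤ (C - 9) * (1 - s ^ 2) := mul_nonneg (by linarith) (by nlinarith)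
  have h3 : s ^ 3 ≤ 1 := pow_le_one₀ h0 h1
  nlinarith [pow_nonneg h0 3, mul_nonneg (sub_nonneg.2 h1) h0,
    mul_nonneg (mul_nonneg (sub_nonneg.2 h1) h0) h0]

theorem angularSpeed_pos {C a : ℝ} (hC : 9 ≤ C) (ha : a ^ 2 < 1) (hE : energyDeficit C a < 1)
    (ψ : ℝ) : 0 < angularSpeed C a ψ := by
  have hs := sphereRadius_pos ((mul_cos_sq_le a ψ).trans_lt ha)
  have hq := deficitQuotient_pos (C := C) (by linarith) hs (sphereRadius_pos ha)
  have hW := one_sub_energyDeficit_le hC ha ψ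
  exact mul_pos (by norm_num) (sqrt_pos.2 (mul_pos hq (by linarith)))

theorem angularSpeed_periodic (C a : ℝ) : Function.Periodic (angularSpeed C a) π := fun ψ => by
  simp only [angularSpeed, cos_add_pi, sin_add_pi, mul_neg, sphereRadius, neg_sq]

theorem angularSpeed_zero (C ψ : ℝ) : angularSpeed C 0 ψ = 9 * √(C + 3) / 2 := by
  have h : deficitQuotient C 1 1 = (C + 3) / 2 ^ 2 := by
    unfold deficitQuotient; ring
  simp [angularSpeed, sphereRadius, h, sqrt_div']
  ring

theorem continuousOn_angularSpeed (C : ℝ) :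
    ContinuousOn (fun z : ℝ × ℝ => angularSpeed C z.1 z.2) {z | z.1 ^ 2 < 1} := by
  have hc := continuous_sphereRadius
  have hne : ∀ z ∈ {z : ℝ × ℝ | z.1 ^ 2 < 1},
      2 * (sphereRadius (z.1 * cos z.2) + sphereRadius z.1) ≠ 0 := fun z hz => by
    have := sphereRadius_pos hz
    have := sphereRadius_nonneg (z.1 * cos z.2)
    positivity
  unfold angularSpeed deficitQuotient
  fun_prop (disch := assumption)

theorem strictMonoOn_energyDeficit {C : ℝ} (hC : 0 < C) :
    StrictMonoOn (energyDeficit C) (Icc 0 1) := fun x hx y hy hxy => by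
  have h : sphereRadius y ≤ sphereRadius x := sqrt_le_sqrt (by nlinarith [hx.1])
  have h3 := pow_le_pow_left₀ (sphereRadius_nonneg y) h 3
  have : x ^ 2 < y ^ 2 := by nlinarith [hx.1]
  unfold energyDeficit
  nlinarith

theorem angularSpeed_le {C a ε ψ : ℝ} (hC : 9 ≤ C) (ha : a ^ 2 < 1) (hε : 0 < ε)
    (hE : energyDeficit C a = 1 - ε ^ 2) (hψ : ψ ∈ Icc 0 (π / 2)) :
    angularSpeed C a ψ ≤ 9 * C * (ε + π / 2 - ψ) := by
  have hs := sphereRadius_pos ((mul_cos_sq_le a ψ).trans_lt ha)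
  have hq := deficitQuotient_le (C := C) hs (sphereRadius_pos ha) (sphereRadius_le_one _)
    (sphereRadius_le_one _)
  have hW0 := one_sub_energyDeficit_le hC ha ψ
  have hW := sub_sq_mul_deficitQuotient (C := C) ha ψ
  have hs3 : sphereRadius (a * cos ψ) ^ 3 ≤ 1 := pow_le_one₀ hs.le (sphereRadius_le_one _)
  have hcos0 : 0 ≤ cos ψ := cos_nonneg_of_mem_Icc ⟨by linarith [hψ.1, pi_pos], hψ.2⟩
  have hcos : cos ψ ≤ π / 2 - ψ := by
    rw [← sin_pi_div_two_sub]; exact sin_le (by linarith [hψ.2])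
  have hx : (a * cos ψ) ^ 2 ≤ cos ψ ^ 2 := by
    rw [mul_pow]; exact mul_le_of_le_one_left (sq_nonneg _) ha.le
  unfold angularSpeed
  rw [mul_assoc]
  gcongr
  have hb : 0 ≤ ε + π / 2 - ψ := by linarith
  refine sqrt_le_iff.2 ⟨by positivity, ?_⟩
  calc _ ≤ C * (C * (ε + π / 2 - ψ) ^ 2) := by
        refine mul_le_mul (by linarith) ?_ (by nlinarith) (by linarith)
        rw [hW]
        have h1 : ε ^ 2 + cos ψ ^ 2 ≤ (ε + π / 2 - ψ) ^ 2 := by nlinarith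
        nlinarith [sq_nonneg ε, sq_nonneg (cos ψ)]
    _ = _ := by ring

theorem integral_inv_angularSpeed_ge {C a ε : ℝ} (hC : 9 ≤ C) (ha : a ^ 2 < 1) (hε : 0 < ε)
    (hE : energyDeficit C a = 1 - ε ^ 2) :
    -log ε / (9 * C) ≤ ∫ ψ in (0 : ℝ)..π, (angularSpeed C a ψ)⁻¹ := by
  have hpos := angularSpeed_pos hC ha (by rw [hE]; nlinarith)
  have hcont : Continuous (angularSpeed C a) :=
    (continuousOn_angularSpeed C).comp_continuous (f := fun ψ => (a, ψ)) (by fun_prop)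
      fun _ => ha
  have hci : Continuous fun ψ => (angularSpeed C a ψ)⁻¹ := hcont.inv₀ fun ψ => (hpos ψ).ne'
  have hden : ∀ ψ ∈ Icc 0 (π / 2), 0 < ε + π / 2 - ψ := fun ψ hψ => by linarith [hψ.2]
  have hlog : ∫ ψ in (0 : ℝ)..π / 2, (ε + π / 2 - ψ)⁻¹ = log ((ε + π / 2) / ε) := by
    rw [intervalIntegral.integral_comp_sub_left (fun y => y⁻¹) (ε + π / 2),
      integral_inv_of_pos (by linarith) (by linarith [pi_pos])]
    congr 2 <;> ring
  calc -log ε / (9 * C) ≤ (9 * C)⁻¹ * log ((ε + π / 2) / ε) := by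
        rw [log_div (by positivity) hε.ne', div_eq_inv_mul]
        have : 0 ≤ log (ε + π / 2) := log_nonneg (by linarith [pi_gt_three])
        gcongr
        linarith
    _ = ∫ ψ in (0 : ℝ)..π / 2, (9 * C)⁻¹ * (ε + π / 2 - ψ)⁻¹ := by
        rw [integral_const_mul, hlog]
    _ ≤ ∫ ψ in (0 : ℝ)..π / 2, (angularSpeed C a ψ)⁻¹ := by
        refine integral_mono_on (by positivity) ?_ (hci.intervalIntegrable _ _) fun ψ hψ => ?_
        · refine ContinuousOn.intervalIntegrable ?_
          rw [uIcc_of_le (by positivity)]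
          exact continuousOn_const.mul
            (ContinuousOn.inv₀ (by fun_prop) fun ψ hψ => (hden ψ hψ).ne')
        · rw [← mul_inv]
          exact inv_anti₀ (hpos ψ) (angularSpeed_le hC ha hε hE hψ)
    _ ≤ ∫ ψ in (0 : ℝ)..π, (angularSpeed C a ψ)⁻¹ := by
        refine integral_mono_interval le_rfl (by positivity) (by linarith [pi_pos])
          (Filter.Eventually.of_forall fun ψ => (inv_pos.2 (hpos ψ)).le)
          (hci.intervalIntegrable _ _)

theorem exists_integral_inv_angularSpeed_eq {C T : ℝ} (hC : 9 ≤ C)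
    (hT : 2 * π / (9 * √(C + 3)) < T) :
    ∃ a, 0 < a ∧ a < 1 ∧ energyDeficit C a < 1 ∧
      ∫ ψ in (0 : ℝ)..π, (angularSpeed C a ψ)⁻¹ = T := by
  have hT0 : 0 < T := lt_of_le_of_lt (by positivity) hT
  set ε := exp (-(9 * C * T)) with hεdef
  have hε : 0 < ε := exp_pos _
  have hε1 : ε < 1 := Real.exp_lt_one_iff.2 (by nlinarith)
  have hE0 : energyDeficit C 0 = 0 := by simp [energyDeficit, sphereRadius]
  have hE1 : energyDeficit C 1 = C / 4 + 1 / 2 := by simp [energyDeficit, sphereRadius]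
  have hEc : Continuous (energyDeficit C) := by
    have := continuous_sphereRadius
    unfold energyDeficit; fun_prop
  obtain ⟨b, hb, hEb⟩ : 1 - ε ^ 2 ∈ energyDeficit C '' Icc 0 1 :=
    intermediate_value_Icc zero_le_one hEc.continuousOn
      ⟨by rw [hE0]; nlinarith, by rw [hE1]; nlinarith⟩
  have hb1 : b < 1 := by
    refine lt_of_le_of_ne hb.2 fun h => ?_
    rw [h, hE1] at hEb
    nlinarith
  have hsq : ∀ a ∈ Icc 0 b, a ^ 2 < 1 := fun a ha => by nlinarith [ha.1, ha.2]
  have hEa : ∀ a ∈ Icc 0 b, energyDeficit C a < 1 := fun a ha => by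
    have := (strictMonoOn_energyDeficit (C := C) (by linarith)).monotoneOn
      ⟨ha.1, ha.2.trans hb.2⟩ hb ha.2
    nlinarith
  have hcont : ContinuousOn (fun a => ∫ ψ in (0 : ℝ)..π, (angularSpeed C a ψ)⁻¹) (Icc 0 b) := by
    rw [continuousOn_iff_continuous_domRestrict]
    refine continuous_parametric_intervalIntegral_of_continuous'
      (f := fun (a : Icc 0 b) ψ => (angularSpeed C a ψ)⁻¹) ?_ 0 π
    refine Continuous.inv₀ ?_ fun z =>
      (angularSpeed_pos hC (hsq _ z.1.2) (hEa _ z.1.2) _).ne'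
    exact (continuousOn_angularSpeed C).comp_continuous
      (f := fun z : Icc 0 b × ℝ => ((z.1 : ℝ), z.2)) (by fun_prop) fun z => hsq _ z.1.2
  have h0 : ∫ ψ in (0 : ℝ)..π, (angularSpeed C 0 ψ)⁻¹ = 2 * π / (9 * √(C + 3)) := by
    simp only [angularSpeed_zero, integral_const, smul_eq_mul, inv_div, sub_zero]
    ring
  have hTb : T ≤ ∫ ψ in (0 : ℝ)..π, (angularSpeed C b ψ)⁻¹ := by
    refine le_trans (le_of_eq ?_)
      (integral_inv_angularSpeed_ge hC (hsq b ⟨hb.1, le_rfl⟩) hε hEb)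
    rw [hεdef, log_exp]
    field_simp
  obtain ⟨a, ha, haT⟩ := intermediate_value_Icc hb.1 hcont ⟨by rw [h0]; exact hT.le, hTb⟩
  refine ⟨a, lt_of_le_of_ne ha.1 fun h => ?_, ha.2.trans_lt hb1, hEa a ha, haT⟩
  rw [← h] at haT
  exact hT.ne (h0.symm.trans haT)

/-- Sine of the phase `φ` along the orbit `1 - 2 K = a cos ψ`. -/
noncomputable def phaseSine (C a ψ : ℝ) : ℝ :=
  -(a * sin ψ) *
    √(deficitQuotient C (sphereRadius (a * cos ψ)) (sphereRadius a) /
      sphereRadius (a * cos ψ) ^ 3)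

theorem hasDerivAt_deficitQuotient (C : ℝ) {s s₀ : ℝ} (h : s + s₀ ≠ 0) :
    HasDerivAt (fun s => deficitQuotient C s s₀)
      ((s ^ 2 + 2 * s * s₀) / (2 * (s + s₀) ^ 2)) s := by
  have hid := hasDerivAt_id' s
  have := ((((hid.pow 2).add (hid.mul_const s₀)).add_const (s₀ ^ 2)).div
    ((hid.add_const s₀).const_mul 2) (by simpa using h)).const_add (C / 4)
  refine this.congr_deriv ?_
  simp only [Pi.add_apply, Pi.pow_apply]
  field_simp
  ring

theorem hasDerivAt_sphereRadius_mul_cos {a : ℝ} (ha : a ^ 2 < 1) (ψ : ℝ) :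
    HasDerivAt (fun ψ => sphereRadius (a * cos ψ))
      (a * cos ψ * (a * sin ψ) / sphereRadius (a * cos ψ)) ψ := by
  have hx := (mul_cos_sq_le a ψ).trans_lt ha
  have := ((((hasDerivAt_cos ψ).const_mul a).pow 2).const_sub 1).sqrt (by
    simp only [Pi.pow_apply]; linarith)
  refine this.congr_deriv ?_
  simp only [Pi.pow_apply, sphereRadius]
  have : 0 < √(1 - (a * cos ψ) ^ 2) := sqrt_pos.2 (by linarith)
  field_simp
  ring

theorem phaseSine_sq {C a : ℝ} (hC : 0 < C) (ha : a ^ 2 < 1) (ψ : ℝ) :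
    phaseSine C a ψ ^ 2 = (a * sin ψ) ^ 2 *
      deficitQuotient C (sphereRadius (a * cos ψ)) (sphereRadius a) /
        sphereRadius (a * cos ψ) ^ 3 := by
  have hs := sphereRadius_pos ((mul_cos_sq_le a ψ).trans_lt ha)
  have hq := deficitQuotient_pos hC hs (sphereRadius_pos ha)
  rw [phaseSine, mul_pow, sq_sqrt (by positivity), neg_sq, mul_div_assoc]

theorem phaseSine_sq_lt_one {C a : ℝ} (hC : 9 ≤ C) (ha : a ^ 2 < 1)
    (hE : energyDeficit C a < 1) (ψ : ℝ) : phaseSine C a ψ ^ 2 < 1 := by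
  have hs := sphereRadius_pos ((mul_cos_sq_le a ψ).trans_lt ha)
  have := one_sub_energyDeficit_le hC ha ψ
  rw [phaseSine_sq (by linarith) ha, div_lt_one (by positivity)]
  linarith

theorem angularSpeed_eq {C a : ℝ} (hC : 9 ≤ C) (ha : a ^ 2 < 1) (ψ : ℝ) :
    angularSpeed C a ψ = 9 * sphereRadius (a * cos ψ) ^ 3 *
      √(deficitQuotient C (sphereRadius (a * cos ψ)) (sphereRadius a) /
        sphereRadius (a * cos ψ) ^ 3) * √(1 - phaseSine C a ψ ^ 2) := by
  have hs := sphereRadius_pos ((mul_cos_sq_le a ψ).trans_lt ha)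
  have hq := deficitQuotient_pos (C := C) (by linarith) hs (sphereRadius_pos ha)
  rw [phaseSine_sq (by linarith) ha, angularSpeed]
  generalize deficitQuotient C (sphereRadius (a * cos ψ)) (sphereRadius a) = q at *
  generalize sphereRadius (a * cos ψ) = s at *
  rw [mul_assoc, mul_assoc, ← sqrt_mul (by positivity)]
  nth_rw 2 [← sqrt_sq (show 0 ≤ s ^ 3 by positivity)]
  rw [← sqrt_mul (by positivity)]
  congr 2
  field_simp

theorem hasDerivAt_phaseSine {C a : ℝ} (hC : 0 < C) (ha : a ^ 2 < 1) (ψ : ℝ) :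
    ∃ d, HasDerivAt (phaseSine C a) d ψ ∧
      4 * sphereRadius (a * cos ψ) ^ 3 *
        √(deficitQuotient C (sphereRadius (a * cos ψ)) (sphereRadius a) /
          sphereRadius (a * cos ψ) ^ 3) * d =
      -(a * cos ψ) * (C + 3 * sphereRadius (a * cos ψ) * (1 - 2 * phaseSine C a ψ ^ 2)) := by
  have hx := (mul_cos_sq_le a ψ).trans_lt ha
  have hs := sphereRadius_pos hx
  have hs₀ := sphereRadius_pos ha
  have hq := deficitQuotient_pos hC hs hs₀
  have hds := hasDerivAt_sphereRadius_mul_cos ha ψ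
  have hdq := (hasDerivAt_deficitQuotient C (add_pos hs hs₀).ne').comp ψ hds
  have hdw := (hdq.div (hds.pow 3) (pow_pos hs 3).ne').sqrt
    (by simp only [Pi.div_apply, Function.comp_apply, Pi.pow_apply]; positivity)
  have hd := ((hasDerivAt_sin ψ).const_mul a).neg.mul hdw
  refine ⟨_, hd, ?_⟩
  have h1 := sphereRadius_sq hx.le
  have h2 := sphereRadius_sq ha.le
  have h3 : (a * sin ψ) ^ 2 = sphereRadius (a * cos ψ) ^ 2 - sphereRadius a ^ 2 := by
    rw [h1, h2, mul_pow, mul_pow, sin_sq]; ring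
  rw [phaseSine_sq hC ha, h3]
  simp only [Pi.div_apply, Function.comp_apply, Pi.pow_apply, Pi.neg_apply]
  have hqe : deficitQuotient C (sphereRadius (a * cos ψ)) (sphereRadius a) =
    C / 4 + (sphereRadius (a * cos ψ) ^ 2 + sphereRadius (a * cos ψ) * sphereRadius a +
      sphereRadius a ^ 2) / (2 * (sphereRadius (a * cos ψ) + sphereRadius a)) := rfl
  generalize deficitQuotient C (sphereRadius (a * cos ψ)) (sphereRadius a) = q at *
  generalize sphereRadius (a * cos ψ) = s at *
  generalize sphereRadius a = s₀ at *
  have hw : √(q / s ^ 3) ^ 2 = q / s ^ 3 := sq_sqrt (by positivity)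
  have hw0 : 0 < √(q / s ^ 3) := sqrt_pos.2 (by positivity)
  generalize √(q / s ^ 3) = w at *
  have hq' : q = w ^ 2 * s ^ 3 := by rw [hw]; field_simp
  have key : 4 * q + (s ^ 2 - s₀ ^ 2) * (s + 2 * s₀) / (s + s₀) ^ 2 = C + 3 * s := by
    rw [hqe]; field_simp; ring
  have hCe : C = 4 * q + (s ^ 2 - s₀ ^ 2) * (s + 2 * s₀) / (s + s₀) ^ 2 - 3 * s := by linarith
  rw [hCe, ← h3, hq']
  field_simp
  ring

/-- For `C ≥ 9`, every half-period `T̄ > 2π/(9√(C+3))` is realized by a beating orbit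
of the planar system `φ′ = −(9/4)(1−2K)[C + 6(K(1−K))^{1/2} cos(2φ)]`,
`K′ = −18(K(1−K))^{3/2} sin(2φ)`: there are `K₀ ∈ (0, 1/2)` and a `2T̄`-periodic
solution with `φ(0) = 0`, `K(0) = K₀` and `K(0) + K(T̄) = 1`. -/
theorem every_large_half_period_realized (C : ℝ) (hC : 9 ≤ C) :
    ∀ Tbar : ℝ, 2 * Real.pi / (9 * Real.sqrt (C + 3)) < Tbar →
      ∃ (K₀ : ℝ) (φ K : ℝ → ℝ),
        0 < K₀ ∧ K₀ < 1 / 2 ∧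
        (∀ t, 0 < K t ∧ K t < 1) ∧
        (∀ t, HasDerivAt φ
          (-(9 / 4) * (1 - 2 * K t) *
            (C + 6 * Real.sqrt (K t * (1 - K t)) * Real.cos (2 * φ t))) t) ∧
        (∀ t, HasDerivAt K
          (-18 * (K t * (1 - K t)) ^ ((3 : ℝ) / 2) * Real.sin (2 * φ t)) t) ∧
        φ 0 = 0 ∧ K 0 = K₀ ∧
        (∀ t, φ (t + 2 * Tbar) = φ t) ∧
        (∀ t, K (t + 2 * Tbar) = K t) ∧
        K 0 + K Tbar = 1 := by
  intro T hT
  obtain ⟨a, ha0, ha1, hE, hTa⟩ := exists_integral_inv_angularSpeed_eq hC hT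
  have ha : a ^ 2 < 1 := by nlinarith
  have hC0 : 0 < C := by linarith
  obtain ⟨ψ, hψ0, hψd, hψT⟩ := exists_periodic_motion (v := angularSpeed C a) pi_pos
    ((continuousOn_angularSpeed C).comp_continuous (f := fun ψ => (a, ψ)) (by fun_prop)
      fun _ => ha) (angularSpeed_pos hC ha hE) (angularSpeed_periodic C a)
  simp only [hTa] at hψT
  have hψ2 : ∀ t, ψ (t + 2 * T) = ψ t + 2 * π := fun t => by
    rw [two_mul, ← add_assoc, hψT, hψT]; ring
  have hp : ∀ t, -1 < phaseSine C a (ψ t) ∧ phaseSine C a (ψ t) < 1 := fun t =>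
    abs_lt.1 ((sq_lt_one_iff_abs_lt_one _).1 (phaseSine_sq_lt_one hC ha hE (ψ t)))
  have hsin : ∀ t, sin (arcsin (phaseSine C a (ψ t))) = phaseSine C a (ψ t) := fun t =>
    sin_arcsin (hp t).1.le (hp t).2.le
  have hx : ∀ t, (a * cos (ψ t)) ^ 2 < 1 := fun t => (mul_cos_sq_le a _).trans_lt ha
  have hKK : ∀ t, (1 - a * cos (ψ t)) / 2 * (1 - (1 - a * cos (ψ t)) / 2) =
      (sphereRadius (a * cos (ψ t)) / 2) ^ 2 := fun t => by
    rw [div_pow, sphereRadius_sq (hx t).le]; ring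
  refine ⟨(1 - a) / 2, fun t => arcsin (phaseSine C a (ψ t)),
    fun t => (1 - a * cos (ψ t)) / 2, by linarith, by linarith, fun t => ?_, fun t => ?_,
    fun t => ?_, ?_, ?_, fun t => ?_, fun t => ?_, ?_⟩
  · have := abs_lt.1 ((sq_lt_one_iff_abs_lt_one _).1 (hx t))
    constructor <;> linarith
  · obtain ⟨d, hd, hdeq⟩ := hasDerivAt_phaseSine (C := C) hC0 ha (ψ t)
    have h := (hasDerivAt_arcsin (hp t).1.ne' (hp t).2.ne).comp t (hd.comp t (hψd t))
    refine h.congr_deriv ?_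
    have hs := sphereRadius_pos (hx t)
    have hc : 0 < √(1 - phaseSine C a (ψ t) ^ 2) :=
      sqrt_pos.2 (by linarith [phaseSine_sq_lt_one hC ha hE (ψ t)])
    rw [hKK, sqrt_sq (by positivity), cos_two_mul', cos_sq', hsin, angularSpeed_eq hC ha]
    field_simp
    linear_combination 2 * hdeq
  · have h := (((hasDerivAt_cos (ψ t)).comp t (hψd t)).const_mul a).const_sub 1 |>.div_const 2
    refine h.congr_deriv ?_
    have hs := sphereRadius_pos (hx t)
    have hpow : ((sphereRadius (a * cos (ψ t)) / 2) ^ 2) ^ ((3 : ℝ) / 2) =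
        (sphereRadius (a * cos (ψ t)) / 2) ^ 3 := by
      rw [← rpow_natCast, ← rpow_mul (by positivity), ← rpow_natCast]
      norm_num
    rw [hKK, hpow, sin_two_mul, hsin, cos_arcsin, angularSpeed_eq hC ha]
    nth_rw 2 [phaseSine]
    ring
  · simp [hψ0, phaseSine]
  · simp [hψ0]
  · simp [hψ2, phaseSine]
  · simp [hψ2]
  · have := hψT 0
    rw [zero_add, hψ0, zero_add] at this
    simp only [this, hψ0, cos_zero, cos_pi]
    ring
end
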